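/- Let F be a finite field with q elements, k a field in which q is invertible, and M_n the multiplicative monoid of n×n matrices over F. For any subfield k in which the signed quantity μ(j) = (-1)^j q^(C(j,2)) makes sense, the element η_{n-1} = -μ(n)^{-1} · Σ_m μ(srk m) [m], where the sum is over all singular semi-idempotent matrices m in M_n, is a two-sided unit for the ideal a_{n,n-1} of k[M_n] spanned by singular matrices: η_{n-1}·[m] = [m]·η_{n-1} = [m] for every singular m ∈ M_n. -/

import Mathlib

open Polynomial

section

variable {F : Type*} [Field F] {n : ℕ}

/-- A square matrix is semi-idempotent iff its minimal polynomial divides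
`x^ℓ (x - 1)` for some `ℓ`. -/
def IsSemiIdempotent (m : Matrix (Fin n) (Fin n) F) : Prop :=
  ∃ ℓ : ℕ, minpoly F m ∣ X ^ ℓ * (X - 1)

/-- The stable rank of an `n×n` matrix: the rank of `m^N` for `N` large
(the rank sequence stabilizes by index `n`). -/
noncomputable def srk (m : Matrix (Fin n) (Fin n) F) : ℕ :=
  Matrix.rank (m ^ n)

end

/-- The quantity `μ(j) = (-1)^j q^(C(j,2))`, as an element of `k`. -/
def muq (k : Type*) [Field k] (q j : ℕ) : k := (-1) ^ j * (q : k) ^ (j.choose 2)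

/-- The element `η_{n-1} = -μ(n)⁻¹ ∑_m μ(srk m) [m]` of the monoid algebra
`k[M_n]`, summed over all singular semi-idempotent matrices `m`. -/
noncomputable def etaCorankOne (F : Type*) [Field F] [Fintype F] (n : ℕ)
    (k : Type*) [Field k] :
    MonoidAlgebra k (Matrix (Fin n) (Fin n) F) :=
  open scoped Classical in
  (-(muq k (Fintype.card F) n)⁻¹) •
    ∑ m : Matrix (Fin n) (Fin n) F,
      if IsSemiIdempotent m ∧ m.det = 0 then
        muq k (Fintype.card F) (srk m) • MonoidAlgebra.single m (1 : k)
      else 0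

/-- power form of semi-idempotence for an endomorphism -/
def SemiE {F V : Type*} [Field F] [AddCommGroup V] [Module F V] (T : Module.End F V) : Prop :=
  ∃ l : ℕ, T ^ (l + 1) = T ^ l

open scoped Classical in
/-- weight function on endomorphisms -/
noncomputable def wtE (k : Type*) [Field k] (q : ℕ) {F V : Type*} [Field F] [AddCommGroup V]
    [Module F V] (T : Module.End F V) : k :=
  if SemiE T then muq k q (Module.finrank F (LinearMap.ker (T - 1))) else 0

section aux
variable {F : Type*} [Field F] {k : Type*} [Field k]

lemma pow_comp_swap {V U : Type*} [AddCommGroup V] [Module F V] [AddCommGroup U] [Module F U]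
    (x : U →ₗ[F] V) (y : V →ₗ[F] U) (l : ℕ) :
    (y ∘ₗ x : Module.End F U) ^ (l + 1) = y ∘ₗ ((x ∘ₗ y : Module.End F V) ^ l) ∘ₗ x := by
  induction l with
  | zero => ext; simp
  | succ l ih =>
    rw [pow_succ, ih, pow_succ]
    rfl

lemma semiE_swap {V U : Type*} [AddCommGroup V] [Module F V] [AddCommGroup U] [Module F U]
    (x : U →ₗ[F] V) (y : V →ₗ[F] U) (h : SemiE (x ∘ₗ y : Module.End F V)) :
    SemiE (y ∘ₗ x : Module.End F U) := by
  obtain ⟨l, hl⟩ := h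
  exact ⟨l + 1, by rw [pow_comp_swap x y, pow_comp_swap x y, hl]⟩

lemma finrank_swap {V U : Type*} [AddCommGroup V] [Module F V] [AddCommGroup U] [Module F U]
    [FiniteDimensional F U]
    (x : U →ₗ[F] V) (y : V →ₗ[F] U) :
    Module.finrank F (LinearMap.ker ((x ∘ₗ y : Module.End F V) - 1)) ≤
    Module.finrank F (LinearMap.ker ((y ∘ₗ x : Module.End F U) - 1)) := by
  have key : ∀ v ∈ LinearMap.ker ((x ∘ₗ y : Module.End F V) - 1),
      y v ∈ LinearMap.ker ((y ∘ₗ x : Module.End F U) - 1) := by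
    intro v hv
    simp only [LinearMap.mem_ker, LinearMap.sub_apply, LinearMap.comp_apply,
      Module.End.one_apply, sub_eq_zero] at hv ⊢
    rw [hv]
  refine LinearMap.finrank_le_finrank_of_injective (f := y.restrict key) ?_
  rw [← LinearMap.ker_eq_bot, LinearMap.ker_eq_bot']
  rintro ⟨v, hv⟩ h
  have h' : y v = 0 := congrArg Subtype.val h
  simp only [LinearMap.mem_ker, LinearMap.sub_apply, LinearMap.comp_apply,
      Module.End.one_apply, sub_eq_zero] at hv
  rw [h', map_zero] at hv
  exact Subtype.ext hv.symm

lemma wtE_swap (q : ℕ) {V U : Type*} [AddCommGroup V] [Module F V] [AddCommGroup U] [Module F U]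
    [FiniteDimensional F U] [FiniteDimensional F V]
    (x : U →ₗ[F] V) (y : V →ₗ[F] U) :
    wtE k q (x ∘ₗ y : Module.End F V) = wtE k q (y ∘ₗ x : Module.End F U) := by
  have h1 : SemiE (x ∘ₗ y : Module.End F V) ↔ SemiE (y ∘ₗ x : Module.End F U) :=
    ⟨semiE_swap x y, semiE_swap y x⟩
  have h2 := le_antisymm (finrank_swap x y) (finrank_swap y x)
  unfold wtE
  rw [h2]
  by_cases h : SemiE (x ∘ₗ y : Module.End F V)
  · rw [if_pos h, if_pos (h1.1 h)]
  · rw [if_neg h, if_neg (fun h' => h (h1.2 h'))]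

lemma semiE_inj {V : Type*} [AddCommGroup V] [Module F V] (T : Module.End F V)
    (h : SemiE T) (hi : Function.Injective T) : T = 1 := by
  obtain ⟨l, hl⟩ := h
  ext v
  have h1 : (T ^ l) (T v) = (T ^ l) v := by
    rw [← Module.End.mul_apply, ← pow_succ, hl]
  have h2 : Function.Injective (T ^ l) := by
    rw [Module.End.coe_pow]; exact hi.iterate l
  exact h2 h1

lemma muq_succ (q d : ℕ) : muq k q (d + 1) = - ((q : k) ^ d * muq k q d) := by
  unfold muq
  rw [Nat.choose_succ_succ' d 1, Nat.choose_one_right, pow_succ, pow_add]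
  ring

/-- the case where all maps fix the hyperplane -/
lemma caseB [Fintype F] {V : Type*} [AddCommGroup V] [Module F V] [Fintype V]
    (lam : V →ₗ[F] F) (hlam : lam ≠ 0) :
    ∑ w : V, wtE k (Fintype.card F) ((1 : Module.End F V) + lam.smulRight w) = 0 := by
  classical
  have hfd : FiniteDimensional F V := inferInstance
  obtain ⟨d, hd⟩ : ∃ d, Module.finrank F V = d + 1 := by
    refine Nat.exists_eq_succ_of_ne_zero ?_
    intro h0
    have := Module.finrank_zero_iff.mp h0
    exact hlam (LinearMap.ext fun v => by rw [Subsingleton.elim v 0]; simp)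
  have hsurj : Function.Surjective lam := LinearMap.surjective hlam
  have hker : Module.finrank F (LinearMap.ker lam) = d := by
    have := lam.finrank_range_add_finrank_ker
    rw [LinearMap.range_eq_top.mpr hsurj, finrank_top, Module.finrank_self] at this
    omega
  have hval : ∀ w : V, wtE k (Fintype.card F) ((1 : Module.End F V) + lam.smulRight w) =
      (if w = 0 then muq k (Fintype.card F) (d+1) else 0) +
      (if lam w = -1 then muq k (Fintype.card F) d else 0) := by
    intro w
    have hpw : ∀ l : ℕ, ((1 : Module.End F V) + lam.smulRight w) ^ (l+1) =
        ((1 : Module.End F V) + lam.smulRight w) ^ l +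
          (1 + lam w) ^ l • (lam.smulRight w : Module.End F V) := by
      intro l
      have hl : ∀ l : ℕ, (((1 : Module.End F V) + lam.smulRight w) ^ l) w = (1 + lam w) ^ l • w := by
        intro l
        induction l with
        | zero => simp
        | succ l ih =>
          rw [pow_succ', Module.End.mul_apply, ih]
          simp only [map_smul, LinearMap.add_apply, Module.End.one_apply,
            LinearMap.smulRight_apply]
          rw [pow_succ, mul_smul, add_smul (1:F), one_smul]
      rw [pow_succ, mul_add, mul_one]
      congr 1
      ext v
      rw [Module.End.mul_apply, LinearMap.smulRight_apply, map_smul, hl]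
      rw [LinearMap.smul_apply, LinearMap.smulRight_apply, smul_comm]
    have hsemi : SemiE ((1 : Module.End F V) + lam.smulRight w) ↔ (w = 0 ∨ lam w = -1) := by
      constructor
      · rintro ⟨l, hl⟩
        rw [hpw, add_eq_left] at hl
        obtain ⟨e, he⟩ := hsurj 1
        have := LinearMap.congr_fun hl e
        simp only [LinearMap.smul_apply, LinearMap.smulRight_apply, he, one_smul,
          LinearMap.zero_apply, smul_eq_zero] at this
        rcases this with h | h
        · right
          have := eq_zero_of_pow_eq_zero h
          linear_combination this
        · exact Or.inl h
      · rintro (h | h)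
        · exact ⟨0, by subst h; ext; simp⟩
        · exact ⟨1, by rw [hpw, h]; simp⟩
    by_cases h0 : w = 0
    · subst h0
      have : SemiE ((1 : Module.End F V) + lam.smulRight 0) := hsemi.2 (Or.inl rfl)
      rw [wtE, if_pos this]
      have h3 : LinearMap.ker ((1 : Module.End F V) + lam.smulRight 0 - 1) = ⊤ := by
        ext; simp
      rw [h3, finrank_top, hd]
      simp
    · by_cases h1 : lam w = -1
      · have : SemiE ((1 : Module.End F V) + lam.smulRight w) := hsemi.2 (Or.inr h1)
        rw [wtE, if_pos this]
        have h3 : LinearMap.ker ((1 : Module.End F V) + lam.smulRight w - 1) =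
            LinearMap.ker lam := by
          ext v; simp [h0]
        rw [h3, hker]
        simp [h0, h1]
      · have : ¬ SemiE ((1 : Module.End F V) + lam.smulRight w) := by
          rw [hsemi]; tauto
        rw [wtE, if_neg this]
        simp [h0, h1]
  rw [Finset.sum_congr rfl (fun w _ => hval w), Finset.sum_add_distrib]
  rw [Finset.sum_ite_eq' Finset.univ (0 : V), if_pos (Finset.mem_univ _)]
  rw [← Finset.sum_filter, Finset.sum_const, nsmul_eq_mul]
  have hcard : (Finset.univ.filter (fun w : V => lam w = -1)).card = Fintype.card F ^ d := by
    obtain ⟨e, he⟩ := hsurj (-1)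
    rw [← hker, ← Module.card_eq_pow_finrank (K := F) (V := LinearMap.ker lam),
      ← Finset.card_univ]
    symm
    refine Finset.card_bij (fun x _ => x.1 + e) ?_ ?_ ?_
    · rintro ⟨x, hx⟩ _
      simp at hx
      simp [hx, he]
    · rintro ⟨x, hx⟩ _ ⟨y, hy⟩ _ h
      simpa using h
    · intro b hb
      simp at hb
      exact ⟨⟨b - e, by simp [hb, he]⟩, Finset.mem_univ _, by simp⟩
  rw [hcard, muq_succ]
  push_cast
  ring

theorem main_sum [Fintype F] (hq : (Fintype.card F : k) ≠ 0) (d : ℕ) :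
    ∀ (V : Type*) [AddCommGroup V] [Module F V] [Fintype V], Module.finrank F V = d →
    ∀ (lam : V →ₗ[F] F), lam ≠ 0 → ∀ T : Module.End F V,
    ∑ w : V, wtE k (Fintype.card F) (T + lam.smulRight w) = 0 := by
  induction d using Nat.strong_induction_on with
  | _ d IH =>
  intro V _ _ _ hd lam hlam T
  classical
  have hfd : FiniteDimensional F V := inferInstance
  have hsurj : Function.Surjective lam := LinearMap.surjective hlam
  obtain ⟨e, he⟩ := hsurj 1
  -- shift
  have shift : ∀ u : V, ∑ w : V, wtE k (Fintype.card F) (T + lam.smulRight w) =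
      ∑ w : V, wtE k (Fintype.card F) ((T + lam.smulRight u) + lam.smulRight w) := by
    intro u
    rw [← Equiv.sum_comp (Equiv.addLeft u)]
    refine Finset.sum_congr rfl fun w _ => ?_
    congr 1
    ext v
    simp [add_assoc]
  by_cases hA : ∃ x : V, x ≠ 0 ∧ lam x = 0 ∧ T x = 0
  · obtain ⟨x, hx0, hlx, hTx⟩ := hA
    let L : Submodule F V := F ∙ x
    have hL1 : L ≤ LinearMap.ker lam := by
      rw [Submodule.span_singleton_le_iff_mem]; exact hlx
    have hL2 : L ≤ LinearMap.ker T := by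
      rw [Submodule.span_singleton_le_iff_mem]; exact hTx
    let lam' : (V ⧸ L) →ₗ[F] F := L.liftQ lam hL1
    let T' : (V ⧸ L) →ₗ[F] V := L.liftQ T hL2
    let _ : Fintype (V ⧸ L) := Fintype.ofFinite _
    have hlam' : lam' ≠ 0 := by
      intro h
      apply hlam
      ext v
      have := LinearMap.congr_fun h (L.mkQ v)
      simpa [lam'] using this
    have hlt : Module.finrank F (V ⧸ L) < d := by
      have h1 := L.finrank_quotient_add_finrank
      have h2 : Module.finrank F L = 1 := finrank_span_singleton hx0
      omega
    have hfac : ∀ w : V, wtE k (Fintype.card F) (T + lam.smulRight w) =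
        wtE k (Fintype.card F) ((L.mkQ ∘ₗ T' : Module.End F (V ⧸ L)) +
          lam'.smulRight (L.mkQ w)) := by
      intro w
      have h1 : T + lam.smulRight w = (T' + lam'.smulRight w) ∘ₗ L.mkQ := by
        ext v; simp [T', lam']
      have h2 : (L.mkQ ∘ₗ T' : Module.End F (V ⧸ L)) + lam'.smulRight (L.mkQ w) =
          L.mkQ ∘ₗ (T' + lam'.smulRight w) := by
        apply LinearMap.ext; intro v; simp
      rw [h1, h2, wtE_swap]
    simp_rw [hfac]
    obtain ⟨σ, hσ⟩ := (Submodule.mkQ_surjective L).hasRightInverse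
    have hne : (Fintype.card (V ⧸ L) : k) ≠ 0 := by
      rw [Module.card_eq_pow_finrank (K := F) (V := V ⧸ L)]
      push_cast
      exact pow_ne_zero _ hq
    refine (mul_eq_zero.mp ?_).resolve_left hne
    rw [← nsmul_eq_mul, ← Finset.card_univ, ← Finset.sum_const]
    have : ∀ u : V ⧸ L, ∑ w : V, wtE k (Fintype.card F)
          ((L.mkQ ∘ₗ T' : Module.End F (V ⧸ L)) + lam'.smulRight (L.mkQ w)) =
        ∑ w : V, wtE k (Fintype.card F)
          (((L.mkQ ∘ₗ T' : Module.End F (V ⧸ L)) + lam'.smulRight (L.mkQ w))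
            + lam'.smulRight u) := by
      intro u
      rw [← Equiv.sum_comp (Equiv.addRight (σ u))]
      refine Finset.sum_congr rfl fun w _ => ?_
      congr 1
      apply LinearMap.ext; intro v
      have := hσ u
      simp only [Equiv.coe_addRight, map_add, this, LinearMap.add_apply,
        LinearMap.smulRight_apply, smul_add, add_assoc]
    rw [Finset.sum_congr rfl (fun u _ => this u), Finset.sum_comm]
    refine Finset.sum_eq_zero fun w _ => ?_
    exact IH _ hlt (V ⧸ L) rfl lam' hlam' _
  by_cases hB : ∀ x : V, lam x = 0 → T x = x
  · rw [shift (e - T e)]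
    have : T + lam.smulRight (e - T e) = 1 := by
      ext v
      have h1 := hB (v - lam v • e) (by simp [he])
      simp only [map_sub, map_smul] at h1
      simp only [LinearMap.add_apply, LinearMap.smulRight_apply, Module.End.one_apply, smul_sub]
      rw [sub_eq_iff_eq_add] at h1
      rw [h1]; abel
    rw [this]
    exact caseB lam hlam
  · have hinj : ∀ x : V, lam x = 0 → T x = 0 → x = 0 := by
      intro x h1 h2
      by_contra h3
      exact hA ⟨x, h3, h1, h2⟩
    let H' : Submodule F V := (LinearMap.ker lam).map T
    by_cases hH : H' ≤ LinearMap.ker lam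
    · refine Finset.sum_eq_zero fun w _ => ?_
      rw [wtE, if_neg]
      rintro ⟨l, hl⟩
      apply hB
      intro x hx
      have hM : ∀ y, lam y = 0 → (T + lam.smulRight w) y = T y := by
        intro y hy; simp [hy]
      have hst : ∀ y, lam y = 0 → lam (T y) = 0 := fun y hy =>
        hH (Submodule.mem_map_of_mem (f := T) (show y ∈ LinearMap.ker lam from hy))
      have hpow : ∀ (l : ℕ) (y : V), lam y = 0 → ((T + lam.smulRight w) ^ l) y = 0 → y = 0 := by
        intro l
        induction l with
        | zero => intro y _ h; simpa using h
        | succ l ih =>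
          intro y hy h
          rw [pow_succ, Module.End.mul_apply, hM y hy] at h
          exact hinj y hy (ih _ (hst y hy) h)
      have h1 : ((T + lam.smulRight w) ^ l) (T x - x) = 0 := by
        rw [map_sub, ← hM x hx, ← Module.End.mul_apply, ← pow_succ, hl, sub_self]
      exact sub_eq_zero.mp (hpow l _ (by rw [map_sub, hst x hx, hx, sub_zero]) h1)
    · rw [shift (- T e)]
      have hr : ∀ v, (T + lam.smulRight (- T e)) v ∈ H' := by
        intro v
        refine ⟨v - lam v • e, by simp [he], ?_⟩
        simp [sub_eq_add_neg]
      have hTT : ∀ x, lam x = 0 → (T + lam.smulRight (- T e)) x = T x := by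
        intro x hx; simp [hx]
      set T1 : Module.End F V := T + lam.smulRight (- T e) with hT1
      let S : V →ₗ[F] H' := T1.codRestrict H' hr
      let _ : Fintype H' := Fintype.ofFinite _
      have hlam' : lam ∘ₗ H'.subtype ≠ 0 := by
        intro h
        apply hH
        intro y hy
        exact LinearMap.congr_fun h ⟨y, hy⟩
      have hlt : Module.finrank F H' < d := by
        have h1 : Module.finrank F H' ≤ Module.finrank F (LinearMap.ker lam) :=
          Submodule.finrank_map_le T _
        have h2 : Module.finrank F (LinearMap.ker lam) < Module.finrank F V := by
          apply Submodule.finrank_lt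
          rw [Ne, LinearMap.ker_eq_top]
          exact hlam
        omega
      have hout : ∀ w : V, w ∉ H' → wtE k (Fintype.card F) (T1 + lam.smulRight w) = 0 := by
        intro w hw
        rw [wtE, if_neg]
        intro hs
        apply hB
        intro x hx
        have h1 := semiE_inj _ hs (by
          rw [← LinearMap.ker_eq_bot, LinearMap.ker_eq_bot']
          intro y hy
          by_cases hly : lam y = 0
          · apply hinj y hly
            rw [← hTT y hly]
            simpa [hly] using hy
          · exfalso
            apply hw
            have h2 : lam y • w ∈ H' := by
              have h3 : lam y • w = - T1 y := by
                rw [LinearMap.add_apply, LinearMap.smulRight_apply] at hy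
                exact eq_neg_of_add_eq_zero_right hy
              rw [h3]
              exact H'.neg_mem (hr y)
            exact (H'.smul_mem_iff hly).mp h2)
        have h2 := LinearMap.congr_fun h1 x
        rw [LinearMap.add_apply, LinearMap.smulRight_apply, hx, hTT x hx] at h2
        simpa using h2
      have hin : ∀ w : H', wtE k (Fintype.card F) (T1 + lam.smulRight (w : V)) =
          wtE k (Fintype.card F) ((S ∘ₗ H'.subtype : Module.End F H') +
            (lam ∘ₗ H'.subtype).smulRight w) := by
        intro w
        have h1 : T1 + lam.smulRight (w : V) = H'.subtype ∘ₗ (S + lam.smulRight w) := by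
          ext v; simp [S]
        have h2 : (S ∘ₗ H'.subtype : Module.End F H') + (lam ∘ₗ H'.subtype).smulRight w =
            (S + lam.smulRight w) ∘ₗ H'.subtype := by
          ext v; simp
        rw [h1, h2, wtE_swap]
      have hfin := IH _ hlt H' rfl _ hlam' (S ∘ₗ H'.subtype)
      rw [← Finset.sum_congr rfl (fun w _ => hin w)] at hfin
      rw [← hfin, ← Finset.sum_subset (Finset.subset_univ (Finset.univ.filter (· ∈ H')))
        (fun w _ hw => hout w (by simpa using hw))]
      exact Finset.sum_subtype _ (by simp) _

end aux

section mat
variable {F : Type*} [Field F] {k : Type*} [Field k] {n : ℕ}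

lemma semi_iff (m : Matrix (Fin n) (Fin n) F) :
    IsSemiIdempotent m ↔ ∃ l : ℕ, m ^ (l + 1) = m ^ l := by
  unfold IsSemiIdempotent
  refine exists_congr fun l => ?_
  rw [minpoly.dvd_iff]
  simp only [map_mul, map_pow, aeval_X, map_sub, map_one]
  rw [mul_sub, mul_one, ← pow_succ, sub_eq_zero]

lemma semi_iffE (m : Matrix (Fin n) (Fin n) F) :
    IsSemiIdempotent m ↔ SemiE (Matrix.toLin' m) := by
  rw [semi_iff]
  unfold SemiE
  refine exists_congr fun l => ?_
  rw [← Matrix.toLin'_pow, ← Matrix.toLin'_pow]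
  exact (Matrix.toLin'.injective.eq_iff).symm

open scoped Classical in
/-- weight on matrices -/
noncomputable def wtM (k : Type*) [Field k] (q : ℕ) (m : Matrix (Fin n) (Fin n) F) : k :=
  if IsSemiIdempotent m then muq k q (srk m) else 0

lemma srk_eq (m : Matrix (Fin n) (Fin n) F) (h : IsSemiIdempotent m) :
    srk m = Module.finrank F (LinearMap.ker ((Matrix.toLin' m : Module.End F (Fin n → F)) - 1)) := by
  obtain ⟨l, hl⟩ := (semi_iffE m).1 h
  unfold srk
  rw [Matrix.rank_eq_finrank_range_toLin (m ^ n) (Pi.basisFun F (Fin n)) (Pi.basisFun F (Fin n)),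
    Matrix.toLin_eq_toLin', Matrix.toLin'_pow]
  set T : Module.End F (Fin n → F) := Matrix.toLin' m
  suffices hRK : LinearMap.range (T ^ n) = LinearMap.ker (T - 1) by rw [hRK]
  ext v
  simp only [LinearMap.mem_range, LinearMap.mem_ker, LinearMap.sub_apply, Module.End.one_apply]
  constructor
  · rintro ⟨u, rfl⟩
    have h1 : T u - u ∈ LinearMap.ker (T ^ l) := by
      rw [LinearMap.mem_ker, map_sub, ← Module.End.mul_apply, ← pow_succ, hl, sub_self]
    have h2 := Module.End.ker_pow_le_ker_pow_finrank T l h1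
    rw [Module.finrank_fin_fun, LinearMap.mem_ker, map_sub] at h2
    rw [← Module.End.mul_apply, ← pow_succ', pow_succ, Module.End.mul_apply]
    exact h2
  · intro hv
    rw [sub_eq_zero] at hv
    refine ⟨v, ?_⟩
    rw [Module.End.coe_pow]
    exact Function.iterate_fixed hv n

lemma wtM_eq (q : ℕ) (m : Matrix (Fin n) (Fin n) F) :
    wtM k q m = wtE k q (Matrix.toLin' m : Module.End F (Fin n → F)) := by
  unfold wtM wtE
  by_cases h : IsSemiIdempotent m
  · rw [if_pos h, if_pos ((semi_iffE m).1 h), srk_eq m h]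
  · rw [if_neg h, if_neg (fun h' => h ((semi_iffE m).2 h'))]

lemma wtM_transpose (q : ℕ) (m : Matrix (Fin n) (Fin n) F) :
    wtM k q m.transpose = wtM k q m := by
  have h1 : IsSemiIdempotent m.transpose ↔ IsSemiIdempotent m := by
    rw [semi_iff, semi_iff]
    refine exists_congr fun l => ?_
    rw [← Matrix.transpose_pow, ← Matrix.transpose_pow, Matrix.transpose_inj]
  have h2 : srk m.transpose = srk m := by
    unfold srk
    rw [← Matrix.transpose_pow, Matrix.rank_transpose]
  unfold wtM
  rw [h2]
  by_cases h : IsSemiIdempotent m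
  · rw [if_pos h, if_pos (h1.2 h)]
  · rw [if_neg h, if_neg (fun h' => h (h1.1 h'))]

lemma wtM_sum [Fintype F] (hq : (Fintype.card F : k) ≠ 0) (m : Matrix (Fin n) (Fin n) F)
    (lam : Fin n → F) (hlam : lam ≠ 0) :
    ∑ w : Fin n → F, wtM k (Fintype.card F) (m + Matrix.vecMulVec w lam) = 0 := by
  let L : (Fin n → F) →ₗ[F] F := dotProductBilin F F lam
  have hL : L ≠ 0 := by
    intro h
    apply hlam
    ext i
    have := LinearMap.congr_fun h (Pi.single i 1)
    simpa [L] using this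
  have := main_sum (k := k) hq _ (Fin n → F) rfl L hL (Matrix.toLin' m)
  rw [← this]
  refine Finset.sum_congr rfl fun w _ => ?_
  rw [wtM_eq]
  congr 1
  apply LinearMap.ext
  intro v
  simp [L, Matrix.add_mulVec, Matrix.vecMulVec_mulVec]

lemma kill_left [Fintype F] (hq : (Fintype.card F : k) ≠ 0) {B : Type*} [AddCommGroup B]
    [Module k B] (a : Matrix (Fin n) (Fin n) F) (ha : a.det = 0)
    (g : Matrix (Fin n) (Fin n) F → B) :
    ∑ m : Matrix (Fin n) (Fin n) F, wtM k (Fintype.card F) m • g (m * a) = 0 := by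
  classical
  obtain ⟨lam, hlam, hla⟩ := Matrix.exists_vecMul_eq_zero_iff.2 ha
  have hne : (Fintype.card (Fin n → F) : k) ≠ 0 := by
    rw [Module.card_eq_pow_finrank (K := F)]
    push_cast
    exact pow_ne_zero _ hq
  refine (smul_eq_zero.mp ?_).resolve_left hne
  rw [Nat.cast_smul_eq_nsmul, ← Finset.card_univ, ← Finset.sum_const]
  have : ∀ w : Fin n → F,
      ∑ m : Matrix (Fin n) (Fin n) F, wtM k (Fintype.card F) m • g (m * a) =
      ∑ m : Matrix (Fin n) (Fin n) F,
        wtM k (Fintype.card F) (m + Matrix.vecMulVec w lam) • g (m * a) := by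
    intro w
    rw [← Equiv.sum_comp (Equiv.addRight (Matrix.vecMulVec w lam))]
    refine Finset.sum_congr rfl fun m _ => ?_
    rw [Equiv.coe_addRight, add_mul, Matrix.vecMulVec_mul, hla]
    simp
  rw [Finset.sum_congr rfl (fun w _ => this w), Finset.sum_comm]
  refine Finset.sum_eq_zero fun m _ => ?_
  rw [← Finset.sum_smul, wtM_sum hq m lam hlam, zero_smul]

lemma kill_right [Fintype F] (hq : (Fintype.card F : k) ≠ 0) {B : Type*} [AddCommGroup B]
    [Module k B] (a : Matrix (Fin n) (Fin n) F) (ha : a.det = 0)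
    (g : Matrix (Fin n) (Fin n) F → B) :
    ∑ m : Matrix (Fin n) (Fin n) F, wtM k (Fintype.card F) m • g (a * m) = 0 := by
  have h := kill_left (k := k) hq a.transpose (by rw [Matrix.det_transpose, ha])
    (fun x => g x.transpose)
  rw [← h, ← Equiv.sum_comp (Matrix.transposeAddEquiv (Fin n) (Fin n) F).toEquiv]
  refine Finset.sum_congr rfl fun m _ => ?_
  simp [wtM_transpose, Matrix.transpose_mul]

lemma muq_ne_zero {q : ℕ} (hq : (q : k) ≠ 0) (j : ℕ) : muq k q j ≠ 0 :=
  mul_ne_zero (pow_ne_zero _ (by simp)) (pow_ne_zero _ hq)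

lemma eta_eq [Fintype F] (hq : (Fintype.card F : k) ≠ 0) :
    etaCorankOne F n k = (-(muq k (Fintype.card F) n)⁻¹) •
      (∑ m : Matrix (Fin n) (Fin n) F, wtM k (Fintype.card F) m • MonoidAlgebra.single m (1 : k))
      + 1 := by
  classical
  have key : ∀ m : Matrix (Fin n) (Fin n) F,
      (if IsSemiIdempotent m ∧ m.det = 0 then
        muq k (Fintype.card F) (srk m) • MonoidAlgebra.single m (1 : k) else 0) =
      wtM k (Fintype.card F) m • MonoidAlgebra.single m (1 : k) -
      (if m = 1 then muq k (Fintype.card F) n • MonoidAlgebra.single m (1 : k) else 0) := by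
    intro m
    by_cases h1 : m = 1
    · subst h1
      have h2 : IsSemiIdempotent (1 : Matrix (Fin n) (Fin n) F) := by
        rw [semi_iff]; exact ⟨0, by simp⟩
      have h3 : srk (1 : Matrix (Fin n) (Fin n) F) = n := by
        simp [srk, Matrix.rank_one]
      simp [wtM, h2, h3]
    · rw [if_neg h1, sub_zero, wtM]
      by_cases h2 : IsSemiIdempotent m
      · have h3 : m.det = 0 := by
          by_contra h3
          obtain ⟨l, hl⟩ := (semi_iff m).1 h2
          have hu : IsUnit (m ^ l) :=
            ((Matrix.isUnit_iff_isUnit_det m).2 (isUnit_iff_ne_zero.2 h3)).pow l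
          apply h1
          rw [pow_succ] at hl
          exact hu.mul_left_cancel (by rw [hl, mul_one])
        simp [h2, h3]
      · simp [h2]
  have hsum : etaCorankOne F n k = (-(muq k (Fintype.card F) n)⁻¹) •
      ∑ m : Matrix (Fin n) (Fin n) F,
      (wtM k (Fintype.card F) m • MonoidAlgebra.single m (1 : k) -
      (if m = 1 then muq k (Fintype.card F) n • MonoidAlgebra.single m (1 : k) else 0)) := by
    unfold etaCorankOne
    congr 1
    refine Finset.sum_congr rfl fun m _ => ?_
    rw [← key m]
  rw [hsum, Finset.sum_sub_distrib, Finset.sum_ite_eq' Finset.univ, if_pos (Finset.mem_univ _),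
    smul_sub, smul_smul, neg_mul, inv_mul_cancel₀ (muq_ne_zero hq n), MonoidAlgebra.one_def]
  simp

end mat

/-- Kovács' unit in corank one, explicitly: if `q = #F` is invertible in `k`,
then `η_{n-1}` is a two-sided unit for the ideal of `k[M_n]` spanned by singular
matrices: `η_{n-1}·[m] = [m]·η_{n-1} = [m]` for every singular `m ∈ M_n`. -/
theorem etaCorankOne_is_unit (F : Type*) [Field F] [Fintype F] (n : ℕ)
    (k : Type*) [Field k] (hq : (Fintype.card F : k) ≠ 0) :
    ∀ m : Matrix (Fin n) (Fin n) F, m.det = 0 →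
      etaCorankOne F n k * MonoidAlgebra.single m (1 : k) = MonoidAlgebra.single m 1 ∧
      MonoidAlgebra.single m (1 : k) * etaCorankOne F n k = MonoidAlgebra.single m 1 := by
  intro a ha
  constructor
  · rw [eta_eq hq, add_mul, one_mul, smul_mul_assoc, Finset.sum_mul]
    have h := kill_left (k := k) hq a ha (fun x => MonoidAlgebra.single x (1 : k))
    simp only [smul_mul_assoc, MonoidAlgebra.single_mul_single, mul_one]
    rw [h, smul_zero, zero_add]
  · rw [eta_eq hq, mul_add, mul_one, mul_smul_comm, Finset.mul_sum]
    have h := kill_right (k := k) hq a ha (fun x => MonoidAlgebra.single x (1 : k))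
    simp only [mul_smul_comm, MonoidAlgebra.single_mul_single, mul_one]
    rw [h, smul_zero, zero_add]
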